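/- Let A ⊆ B be an extension of commutative rings with ℚ ⊆ A (A is a ℚ-algebra), let ⁺A denote the subintegral closure of A in B, and let M be a positive commutative cancellative torsion-free monoid. Then there is an isomorphism of abelian groups 𝓘(A[M],(⁺A)[M]) ≅ ℤ[M] ⊗_ℤ 𝓘(A,⁺A), where ℤ[M] is the monoid ring of M over ℤ and the tensor product is the tensor product over ℤ of the abelian group underlying ℤ[M] with the abelian group 𝓘(A,⁺A). -/

import Mathlib

open scoped Classical

noncomputable section

set_option maxHeartbeats 1000000
set_option synthInstance.maxHeartbeats 400000

/-- `A` is subintegrally closed in its ambient ring `B`: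
every `b : B` with `b² ∈ A` and `b³ ∈ A` lies in `A`. -/
def Subring.IsSubintegrallyClosedIn {B : Type*} [CommRing B] (A : Subring B) : Prop :=
  ∀ b : B, b ^ 2 ∈ A → b ^ 3 ∈ A → b ∈ A

/-- `M` is subintegrally closed in its ambient monoid `N`:
every `x : N` with `x² ∈ M` and `x³ ∈ M` lies in `M`. -/
def Submonoid.IsSubintegrallyClosedIn {N : Type*} [CommMonoid N] (M : Submonoid N) : Prop :=
  ∀ x : N, x ^ 2 ∈ M → x ^ 3 ∈ M → x ∈ M

/-- A commutative monoid is torsion-free. -/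
def MulTorsionFree (N : Type*) [CommMonoid N] : Prop :=
  ∀ (x y : N) (n : ℕ), n ≠ 0 → x ^ n = y ^ n → x = y

/-- A commutative monoid is positive if its only unit is the identity. -/
def IsPositiveMonoid (N : Type*) [CommMonoid N] : Prop :=
  ∀ x : N, IsUnit x → x = 1

/-- The subring `A[M]` of the monoid algebra `B[N]`, for a subring `A ⊆ B` and a submonoid
`M ⊆ N`: the subring generated by the elements `a·m` (`a ∈ A`, `m ∈ M`); equivalently, the set
of elements of `B[N]` supported on `M` with all coefficients in `A`. -/
def monoidAlgebraSubring {B : Type*} [CommRing B] {N : Type*} [CommMonoid N]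
    (A : Subring B) (M : Submonoid N) : Subring (MonoidAlgebra B N) :=
  Subring.closure {x | ∃ a ∈ A, ∃ m ∈ M, x = MonoidAlgebra.single m a}

/-- The subintegral closure of `A` in an intermediate ring `C` (for `A ⊆ C ⊆ B`): the smallest
subring `T` of `B` containing `A` such that every `b ∈ C` with `b² ∈ T` and `b³ ∈ T` lies in
`T`. -/
def Subring.subintegralClosureIn {B : Type*} [CommRing B] (A C : Subring B) : Subring B :=
  sInf {T : Subring B | A ≤ T ∧ ∀ b ∈ C, b ^ 2 ∈ T → b ^ 3 ∈ T → b ∈ T}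

/-- The subintegral closure `⁺A` of `A` in `B`: the smallest subring `T` of `B` containing `A`
such that every `b : B` with `b² ∈ T` and `b³ ∈ T` lies in `T`. -/
def Subring.subintegralClosure {B : Type*} [CommRing B] (A : Subring B) : Subring B :=
  A.subintegralClosureIn ⊤

/-- The subintegral closure of `M` in an intermediate monoid `C` (for `M ⊆ C ⊆ G`): the
smallest submonoid `T` of `G` containing `M` such that every `x ∈ C` with `x² ∈ T` and
`x³ ∈ T` lies in `T`. -/
def Submonoid.subintegralClosureIn {G : Type*} [CommMonoid G] (M C : Submonoid G) : Submonoid G :=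
  sInf {T : Submonoid G | M ≤ T ∧ ∀ x ∈ C, x ^ 2 ∈ T → x ^ 3 ∈ T → x ∈ T}

/-- The group of invertible `A`-submodules of an intermediate ring `T`, for nested subrings
`A ⊆ T ⊆ B`, is a commutative group.  (Stated as an explicit instance to help typeclass
resolution through the nested subtypes.) -/
instance instCommGroupUnitsSubmoduleComapSubtype {B : Type*} [CommRing B] (A T : Subring B) :
    CommGroup (Submodule (A.comap T.subtype) T)ˣ :=
  @Units.instCommGroupUnits _ (inferInstance : CommMonoid (Submodule (A.comap T.subtype) T))

/-- If `N / Γ` is divisible, then it has a complement in `Ψ / Γ`. -/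
theorem AddSubgroup.exists_complement_above {Y : Type*} [AddCommGroup Y] {Γ N Ψ : AddSubgroup Y}
    (hΓN : Γ ≤ N) (hNΨ : N ≤ Ψ)
    (hdiv : ∀ y ∈ N, ∀ k : ℤ, k ≠ 0 → ∃ z ∈ N, y - k • z ∈ Γ) :
    ∃ Γ' : AddSubgroup Y, Γ ≤ Γ' ∧ Γ' ≤ Ψ ∧ (∀ y ∈ Γ', y ∈ N → y ∈ Γ) ∧
      ∀ y ∈ Ψ, ∃ n ∈ N, y - n ∈ Γ' := by
  let Q := N ⧸ Γ.addSubgroupOf N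
  have hsurj : ∀ {k : ℤ}, k ≠ 0 → Function.Surjective (fun a : Q ↦ k • a) := by
    intro k hk a
    obtain ⟨⟨y, hy⟩, rfl⟩ := QuotientAddGroup.mk_surjective a
    obtain ⟨z, hz, hyz⟩ := hdiv y hy k hk
    refine ⟨QuotientAddGroup.mk ⟨z, hz⟩, ?_⟩
    change QuotientAddGroup.mk (k • (⟨z, hz⟩ : N)) = _
    rw [QuotientAddGroup.eq, AddSubgroup.mem_addSubgroupOf]
    simpa [sub_eq_neg_add] using hyz
  let _ : DivisibleBy Q ℤ := divisibleByOfSMulRightSurj Q ℤ hsurj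
  obtain ⟨r, hr⟩ := (Module.Baer.of_divisible Q).extension_property_addMonoidHom
    N.subtype N.subtype_injective (QuotientAddGroup.mk' (Γ.addSubgroupOf N))
  have hrN : ∀ n (hn : n ∈ N), r n = QuotientAddGroup.mk' (Γ.addSubgroupOf N) ⟨n, hn⟩ :=
    fun n hn ↦ DFunLike.congr_fun hr ⟨n, hn⟩
  have hrΓ : ∀ n ∈ N, r n = 0 ↔ n ∈ Γ := by
    intro n hn
    rw [hrN n hn]
    change ((⟨n, hn⟩ : N) : Q) = 0 ↔ _
    rw [QuotientAddGroup.eq_zero_iff, AddSubgroup.mem_addSubgroupOf]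
  refine ⟨r.ker ⊓ Ψ, fun y hy ↦ ⟨(hrΓ y (hΓN hy)).2 hy, hNΨ (hΓN hy)⟩, inf_le_right,
    fun y hy hyN ↦ (hrΓ y hyN).1 hy.1, fun y hy ↦ ?_⟩
  obtain ⟨⟨n, hn⟩, h⟩ := QuotientAddGroup.mk_surjective (r y)
  refine ⟨n, hn, AddMonoidHom.mem_ker.2 ?_, Ψ.sub_mem hy (hNΨ hn)⟩
  rw [map_sub, hrN n hn, ← h]
  exact sub_self _

/-- A subring regarded as an additive subgroup, i.e. as a `ℤ`-submodule. -/
def Subring.toZSubmodule {S : Type*} [CommRing S] (T : Subring S) : Submodule ℤ S :=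
  AddSubgroup.toIntSubmodule T.toAddSubgroup

/-- `J` and `J'` are mutually inverse invertible `T`-submodules, regarded as `ℤ`-submodules of the
ambient ring. -/
structure IsInvertiblePair {S : Type*} [CommRing S] (T : Subring S) (J J' : Submodule ℤ S) :
    Prop where
  mul_left : J * T.toZSubmodule = J
  mul_right : J' * T.toZSubmodule = J'
  mul_eq : J * J' = T.toZSubmodule

section Pairs

variable {S : Type*} [CommRing S]

theorem Subring.mem_toZSubmodule {T : Subring S} {x : S} : x ∈ T.toZSubmodule ↔ x ∈ T := Iff.rfl

theorem Subring.toZSubmodule_mono {T T' : Subring S} (h : T ≤ T') :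
    T.toZSubmodule ≤ T'.toZSubmodule := fun _ hx ↦ h hx

theorem Subring.toZSubmodule_mul_of_le {T T' : Subring S} (h : T ≤ T') :
    T'.toZSubmodule * T.toZSubmodule = T'.toZSubmodule := by
  refine le_antisymm (Submodule.mul_le.2 fun x hx y hy ↦ T'.mul_mem hx (h hy)) fun x hx ↦ ?_
  simpa using Submodule.mul_mem_mul hx (show (1 : S) ∈ T.toZSubmodule from T.one_mem)

theorem Subring.le_mul_toZSubmodule (T : Subring S) (I : Submodule ℤ S) :
    I ≤ I * T.toZSubmodule := fun x hx ↦ by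
  simpa using Submodule.mul_mem_mul hx (show (1 : S) ∈ T.toZSubmodule from T.one_mem)

theorem IsInvertiblePair.symm {T : Subring S} {J J' : Submodule ℤ S}
    (h : IsInvertiblePair T J J') : IsInvertiblePair T J' J :=
  ⟨h.mul_right, h.mul_left, by rw [mul_comm, h.mul_eq]⟩

theorem exists_finite_sum_of_mem_mul {I J : Submodule ℤ S} {x : S} (hx : x ∈ I * J) :
    ∃ (ι : Type) (_ : Fintype ι) (f g : ι → S), (∀ i, f i ∈ I) ∧ (∀ i, g i ∈ J) ∧
      ∑ i, f i * g i = x := by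
  refine Submodule.mul_induction_on hx (fun m hm n hn ↦ ?_) fun x y hx hy ↦ ?_
  · exact ⟨Unit, inferInstance, fun _ ↦ m, fun _ ↦ n, fun _ ↦ hm, fun _ ↦ hn, by simp⟩
  · obtain ⟨ι, _, f, g, hf, hg, rfl⟩ := hx
    obtain ⟨κ, _, f', g', hf', hg', rfl⟩ := hy
    refine ⟨ι ⊕ κ, inferInstance, Sum.elim f f', Sum.elim g g', ?_, ?_, ?_⟩
    · rintro (i | i) <;> simp [hf, hf']
    · rintro (i | i) <;> simp [hg, hg']
    · simp

theorem IsInvertiblePair.exists_dual_families {T : Subring S} {J J' : Submodule ℤ S}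
    (h : IsInvertiblePair T J J') :
    ∃ (ι : Type) (_ : Fintype ι) (f g : ι → S), (∀ i, f i ∈ J) ∧ (∀ i, g i ∈ J') ∧
      ∑ i, f i * g i = 1 :=
  exists_finite_sum_of_mem_mul (h.mul_eq ▸ T.one_mem)

theorem IsInvertiblePair.mul_mem {T : Subring S} {J J' : Submodule ℤ S}
    (h : IsInvertiblePair T J J') {x y : S} (hx : x ∈ J) (hy : y ∈ J') : x * y ∈ T :=
  Subring.mem_toZSubmodule.1 (h.mul_eq ▸ Submodule.mul_mem_mul hx hy)

theorem IsInvertiblePair.smul_mem {T : Subring S} {J J' : Submodule ℤ S}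
    (h : IsInvertiblePair T J J') {x t : S} (hx : x ∈ J) (ht : t ∈ T) : x * t ∈ J :=
  h.mul_left ▸ Submodule.mul_mem_mul hx (Subring.mem_toZSubmodule.2 ht)

/-- A pair of dual families with pairings in `T` spans an invertible pair. -/
theorem isInvertiblePair_span {T : Subring S} {ι : Type} [Fintype ι] {f g : ι → S}
    (hfg : ∀ i j, f i * g j ∈ T) (h1 : ∑ i, f i * g i = 1) :
    IsInvertiblePair T (Submodule.span ℤ (Set.range f) * T.toZSubmodule)
      (Submodule.span ℤ (Set.range g) * T.toZSubmodule) := by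
  have h2 := Subring.toZSubmodule_mul_of_le (le_refl T)
  refine ⟨by rw [mul_assoc, h2], by rw [mul_assoc, h2], le_antisymm ?_ ?_⟩
  · rw [mul_mul_mul_comm, h2, Submodule.span_mul_span]
    refine (mul_le_mul_left (Submodule.span_le.2 ?_) _).trans h2.le
    rintro _ ⟨_, ⟨i, rfl⟩, _, ⟨j, rfl⟩, rfl⟩
    exact hfg i j
  · rw [mul_mul_mul_comm, h2]
    have : (1 : S) ∈ Submodule.span ℤ (Set.range f) * Submodule.span ℤ (Set.range g) :=
      h1 ▸ Submodule.sum_mem _ fun i _ ↦ Submodule.mul_mem_mul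
        (Submodule.subset_span ⟨i, rfl⟩) (Submodule.subset_span ⟨i, rfl⟩)
    intro x hx
    simpa using Submodule.mul_mem_mul this hx

end Pairs

/-- `T'` is obtained from `T` by adjoining an element `b` with `b², b³ ∈ T`. -/
structure IsElementaryExtension {S : Type*} [CommRing S] (T T' : Subring S) (b : S) : Prop where
  sq_mem : b ^ 2 ∈ T
  cube_mem : b ^ 3 ∈ T
  mem_iff : ∀ x, x ∈ T' ↔ ∃ p ∈ T, ∃ q ∈ T, x = p + b * q

section Elementary

variable {S : Type*} [CommRing S]

theorem exists_isElementaryExtension {T : Subring S} {b : S} (h2 : b ^ 2 ∈ T) (h3 : b ^ 3 ∈ T) :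
    ∃ T' : Subring S, IsElementaryExtension T T' b := by
  refine ⟨{ carrier := {x | ∃ p ∈ T, ∃ q ∈ T, x = p + b * q}
            mul_mem' := ?_, one_mem' := ⟨1, T.one_mem, 0, T.zero_mem, by ring⟩
            add_mem' := ?_, zero_mem' := ⟨0, T.zero_mem, 0, T.zero_mem, by ring⟩
            neg_mem' := ?_ }, h2, h3, fun x ↦ Iff.rfl⟩
  · rintro _ _ ⟨p, hp, q, hq, rfl⟩ ⟨p', hp', q', hq', rfl⟩
    exact ⟨p * p' + b ^ 2 * (q * q'), T.add_mem (T.mul_mem hp hp')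
      (T.mul_mem h2 (T.mul_mem hq hq')), p * q' + q * p',
      T.add_mem (T.mul_mem hp hq') (T.mul_mem hq hp'), by ring⟩
  · rintro _ _ ⟨p, hp, q, hq, rfl⟩ ⟨p', hp', q', hq', rfl⟩
    exact ⟨p + p', T.add_mem hp hp', q + q', T.add_mem hq hq', by ring⟩
  · rintro _ ⟨p, hp, q, hq, rfl⟩
    exact ⟨-p, T.neg_mem hp, -q, T.neg_mem hq, by ring⟩

namespace IsElementaryExtension

variable {T T' : Subring S} {b : S} (h : IsElementaryExtension T T' b)
include h

theorem le : T ≤ T' := fun x hx ↦ (h.mem_iff x).2 ⟨x, hx, 0, T.zero_mem, by ring⟩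

theorem mul_mem {t : S} (ht : t ∈ T) : b * t ∈ T' :=
  (h.mem_iff _).2 ⟨0, T.zero_mem, t, ht, by ring⟩

theorem gen_mem : b ∈ T' := by simpa using h.mul_mem T.one_mem

theorem sq_mul_mem {x : S} (hx : x ∈ T') : b ^ 2 * x ∈ T := by
  obtain ⟨p, hp, q, hq, rfl⟩ := (h.mem_iff x).1 hx
  have : b ^ 2 * (p + b * q) = b ^ 2 * p + b ^ 3 * q := by ring
  rw [this]
  exact T.add_mem (T.mul_mem h.sq_mem hp) (T.mul_mem h.cube_mem hq)

theorem span_sq_mul_le : Submodule.span ℤ {b ^ 2} * T'.toZSubmodule ≤ T.toZSubmodule := by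
  intro x hx
  obtain ⟨y, hy, rfl⟩ := Submodule.mem_span_singleton_mul.1 hx
  exact h.sq_mul_mem hy

/-- A `T`-submodule of `T` that generates the unit ideal of `T'` contains `1`. -/
theorem one_mem_of_mul_eq {K : Submodule ℤ S} (hK : K ≤ T.toZSubmodule)
    (hKT : K * T.toZSubmodule = K) (hKT' : K * T'.toZSubmodule = T'.toZSubmodule) :
    (1 : S) ∈ K := by
  have hmul : ∀ k ∈ K, ∀ t ∈ T, k * t ∈ K := fun k hk t ht ↦
    hKT ▸ Submodule.mul_mem_mul hk (Subring.mem_toZSubmodule.2 ht)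
  have hdecomp : ∀ x ∈ K * T'.toZSubmodule, ∃ k ∈ K, ∃ l ∈ K, x = k + b * l := by
    intro x hx
    refine Submodule.mul_induction_on hx ?_ ?_
    · intro k hk y hy
      obtain ⟨p, hp, q, hq, rfl⟩ := (h.mem_iff y).1 hy
      exact ⟨k * p, hmul k hk p hp, k * q, hmul k hk q hq, by ring⟩
    · rintro _ _ ⟨k, hk, l, hl, rfl⟩ ⟨k', hk', l', hl', rfl⟩
      exact ⟨k + k', K.add_mem hk hk', l + l', K.add_mem hl hl', by ring⟩
  obtain ⟨k, hk, l, hl, hkl⟩ := hdecomp 1 (hKT'.symm ▸ Subring.mem_toZSubmodule.2 T'.one_mem)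
  have hbl : b * l ∈ T := by
    have : b * l = 1 - k := by rw [hkl]; ring
    exact this ▸ T.sub_mem T.one_mem (hK hk)
  have h1 : k * (1 + b * l) ∈ K := hmul k hk _ (T.add_mem T.one_mem hbl)
  have h2 : l * (b ^ 2 * l) ∈ K := hmul l hl _ (T.mul_mem h.sq_mem (hK hl))
  have : (1 : S) = k * (1 + b * l) + l * (b ^ 2 * l) := by
    have : k = 1 - b * l := by rw [hkl]; ring
    rw [this]; ring
  exact this ▸ K.add_mem h1 h2

theorem le_of_generators {J L : Submodule ℤ S} {ι : Type} [Fintype ι] {f f' x g : ι → S}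
    (hg : ∀ y ∈ J, ∑ i, f i * (g i * y) = y) (hgJ : ∀ i, ∀ y ∈ J, g i * y ∈ T')
    (hf : ∀ i, f i = f' i + b * x i) (hx : ∀ i, x i ∈ J) (hf' : ∀ i, f' i ∈ L)
    (hsq : ∀ y ∈ J, b ^ 2 * y ∈ L) (hL : L * T'.toZSubmodule = L) : J ≤ L := by
  have hmul : ∀ k ∈ L, ∀ t ∈ T', k * t ∈ L := fun k hk t ht ↦
    hL ▸ Submodule.mul_mem_mul hk (Subring.mem_toZSubmodule.2 ht)
  have hb : ∀ y ∈ J, b * y ∈ L := by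
    intro y hy
    have hbf : ∀ i, b * f i ∈ L := fun i ↦ by
      have : b * f i = f' i * b + b ^ 2 * x i := by rw [hf]; ring
      rw [this]
      exact L.add_mem (hmul _ (hf' i) _ h.gen_mem) (hsq _ (hx i))
    rw [← hg y hy, Finset.mul_sum]
    refine L.sum_mem fun i _ ↦ ?_
    rw [← mul_assoc]
    exact hmul _ (hbf i) _ (hgJ i y hy)
  intro y hy
  rw [← hg y hy]
  refine L.sum_mem fun i _ ↦ hmul _ ?_ _ (hgJ i y hy)
  rw [hf]
  exact L.add_mem (hf' i) (hb _ (hx i))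

end IsElementaryExtension

/-- If `E + β X` is idempotent with `E`, `X` in a subring `P` containing `β²` and `β³`,
then `β E X E` lies in `P`. -/
theorem Subring.mul_mem_of_isIdempotentElem {W : Type*} [Ring W] (P : Subring W) {β E X : W}
    (hβ : ∀ w, w * β = β * w) (h2 : β ^ 2 ∈ P) (h3 : β ^ 3 ∈ P) (hE : E ∈ P) (hX : X ∈ P)
    (hid : (E + β * X) * (E + β * X) = E + β * X) : β * (E * X * E) ∈ P := by
  have hEβ : E * (β * X) = β * (E * X) := by rw [← mul_assoc, hβ, mul_assoc]
  have hXβ : β * X * (β * X) = β ^ 2 * (X * X) := by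
    rw [mul_assoc, ← mul_assoc X, hβ, pow_two]
    noncomm_ring
  have key : E * E = E + β * (X - (E * X + X * E)) - β ^ 2 * (X * X) := by
    rw [add_mul, mul_add, mul_add, hEβ, hXβ] at hid
    rw [← sub_eq_zero] at hid ⊢
    rw [← hid]
    noncomm_ring
  have hY : β * (E * X + X * E - X) ∈ P := by
    have : β * (E * X + X * E - X) = E - E * E - β ^ 2 * (X * X) := by
      rw [key]
      noncomm_ring
    rw [this]
    exact P.sub_mem (P.sub_mem hE (P.mul_mem hE hE)) (P.mul_mem h2 (P.mul_mem hX hX))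
  have hZ : β * (E * E - E) ∈ P := by
    have : β * (E * E - E) = β ^ 2 * (X - (E * X + X * E)) - β ^ 3 * (X * X) := by
      rw [key]
      noncomm_ring
    rw [this]
    exact P.sub_mem (P.mul_mem h2 (P.sub_mem hX (P.add_mem (P.mul_mem hE hX) (P.mul_mem hX hE))))
      (P.mul_mem h3 (P.mul_mem hX hX))
  have : β * (E * X * E) = E * (β * (E * X + X * E - X)) - β * (E * E - E) * X := by
    rw [← mul_assoc E β, hβ]
    noncomm_ring
  rw [this]
  exact P.sub_mem (P.mul_mem hE hY) (P.mul_mem hZ hX)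

end Elementary

section Lift

variable {S : Type*} [CommRing S]

/-- Invertible modules lift along elementary extensions. -/
theorem IsElementaryExtension.exists_lift {T T' : Subring S} {b : S}
    (h : IsElementaryExtension T T' b) {J J' : Submodule ℤ S} (hJ : IsInvertiblePair T' J J') :
    ∃ L L' : Submodule ℤ S, IsInvertiblePair T L L' ∧ L * T'.toZSubmodule = J := by
  obtain ⟨ι, _, f, g, hf, hg, hfg⟩ := hJ.exists_dual_families
  have hmem : ∀ i j, g i * f j ∈ T' := fun i j ↦ hJ.symm.mul_mem (hg i) (hf j)
  choose p hp q hq hpq using fun i j ↦ (h.mem_iff _).1 (hmem i j)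
  have hTT : T.toZSubmodule * T.toZSubmodule = T.toZSubmodule :=
    Subring.toZSubmodule_mul_of_le le_rfl
  have hT'T := Subring.toZSubmodule_mul_of_le h.le
  have hJT : J * T.toZSubmodule = J := by
    rw [← hJ.mul_left, mul_assoc, hT'T]
  have hJ'T : J' * T.toZSubmodule = J' := by
    rw [← hJ.mul_right, mul_assoc, hT'T]
  -- the idempotent matrix attached to the dual families, reduced modulo `b`
  have hpqp : ∀ i j, (∑ k, p i k * ∑ l, g k * f l * p l j) ∈ T := by
    let E : Matrix ι ι S := Matrix.of p
    let X : Matrix ι ι S := Matrix.of q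
    let β : Matrix ι ι S := Matrix.scalar ι b
    have hβ : ∀ w, w * β = β * w := fun w ↦
      ((Matrix.scalar_commute b (fun r ↦ mul_comm b r) w).eq).symm
    have hscalar : ∀ t ∈ T, Matrix.scalar ι t ∈ T.matrix := by
      intro t ht i j
      rw [Matrix.scalar_apply, Matrix.diagonal_apply]
      split_ifs
      exacts [ht, T.zero_mem]
    have hEX : E + β * X = Matrix.of fun i j ↦ g i * f j := by
      ext i j
      simp [E, X, β, hpq]
    have hE : E ∈ T.matrix := fun i j ↦ hp i j
    have hX : X ∈ T.matrix := fun i j ↦ hq i j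
    have key := T.matrix.mul_mem_of_isIdempotentElem hβ
      (by simpa only [β, map_pow] using hscalar _ h.sq_mem)
      (by simpa only [β, map_pow] using hscalar _ h.cube_mem) hE hX (by
        rw [hEX]
        ext i j
        simp only [Matrix.mul_apply, Matrix.of_apply]
        calc ∑ k, g i * f k * (g k * f j) = g i * (∑ k, f k * g k) * f j := by
              rw [Finset.mul_sum, Finset.sum_mul]
              exact Finset.sum_congr rfl fun _ _ ↦ by ring
          _ = g i * f j := by rw [hfg, mul_one])
    have key' : E * ((E + β * X) * E) ∈ T.matrix := by
      have : E * ((E + β * X) * E) = E * (E * E) + β * (E * X * E) := by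
        rw [add_mul, mul_add, ← mul_assoc E (β * X), ← mul_assoc E β, hβ]
        noncomm_ring
      rw [this]
      exact T.matrix.add_mem (T.matrix.mul_mem hE (T.matrix.mul_mem hE hE)) key
    intro i j
    have : (E * ((E + β * X) * E)) i j ∈ T := key' i j
    rw [hEX] at this
    simpa only [Matrix.mul_apply, E, Matrix.of_apply] using this
  let f' : ι → S := fun j ↦ ∑ i, f i * p i j
  let g' : ι → S := fun i ↦ ∑ j, p i j * g j
  have hf'J : ∀ i, f' i ∈ J := fun j ↦
    J.sum_mem fun i _ ↦ hJ.smul_mem (hf i) (h.le (hp i j))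
  have hg'J : ∀ i, g' i ∈ J' := fun i ↦ J'.sum_mem fun j _ ↦ by
    rw [mul_comm]; exact hJ.symm.smul_mem (hg j) (h.le (hp i j))
  have hgf' : ∀ i j, f' j * g' i ∈ T := fun i j ↦ by
    convert hpqp i j using 1
    simp only [f', g', Finset.mul_sum, Finset.sum_mul]
    exact Finset.sum_congr rfl fun k _ ↦ Finset.sum_congr rfl fun l _ ↦ by ring
  let F := Submodule.span ℤ (Set.range f')
  let G := Submodule.span ℤ (Set.range g')
  let β := Submodule.span ℤ {b ^ 2}
  have hF : F ≤ J := Submodule.span_le.2 (by rintro _ ⟨i, rfl⟩; exact hf'J i)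
  have hG : G ≤ J' := Submodule.span_le.2 (by rintro _ ⟨i, rfl⟩; exact hg'J i)
  have hFG : F * G ≤ T.toZSubmodule := by
    rw [Submodule.span_mul_span, Submodule.span_le]
    rintro _ ⟨_, ⟨j, rfl⟩, _, ⟨i, rfl⟩, rfl⟩
    exact hgf' i j
  have hβT : β * T'.toZSubmodule ≤ T.toZSubmodule := h.span_sq_mul_le
  have hβ : β ≤ T.toZSubmodule := (Subring.le_mul_toZSubmodule _ _).trans hβT
  have hβJ : β * J ≤ J := by
    calc β * J ≤ T.toZSubmodule * J := mul_le_mul' hβ le_rfl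
      _ = J := by rw [mul_comm, hJT]
  have hβJ' : β * J' ≤ J' := by
    calc β * J' ≤ T.toZSubmodule * J' := mul_le_mul' hβ le_rfl
      _ = J' := by rw [mul_comm, hJ'T]
  have hmulmem : ∀ {K : Submodule ℤ S}, ∀ y ∈ K, b ^ 2 * y ∈ β * K := fun y hy ↦
    Submodule.mul_mem_mul (Submodule.mem_span_singleton_self _) hy
  let L := F * T.toZSubmodule ⊔ β * J
  let L' := G * T.toZSubmodule ⊔ β * J'
  have hLJ : L ≤ J := sup_le ((mul_le_mul' hF le_rfl).trans hJT.le) hβJ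
  have hLJ' : L' ≤ J' := sup_le ((mul_le_mul' hG le_rfl).trans hJ'T.le) hβJ'
  have hLT : L * T.toZSubmodule = L := by
    simp only [L]
    rw [Submodule.sup_mul, mul_assoc, hTT, mul_assoc, hJT]
  have hLT'_mul : L' * T.toZSubmodule = L' := by
    simp only [L']
    rw [Submodule.sup_mul, mul_assoc, hTT, mul_assoc, hJ'T]
  have hT'_mul := Subring.toZSubmodule_mul_of_le (le_refl T')
  have hLT' : L * T'.toZSubmodule = J := by
    refine le_antisymm ((mul_le_mul' hLJ le_rfl).trans hJ.mul_left.le) ?_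
    refine h.le_of_generators (f := f) (f' := f') (g := g) (x := fun j ↦ ∑ i, f i * q i j)
      (fun y _ ↦ ?_) (fun i y hy ↦ hJ.symm.mul_mem (hg i) hy) (fun j ↦ ?_)
      (fun j ↦ J.sum_mem fun i _ ↦ hJ.smul_mem (hf i) (h.le (hq i j)))
      (fun i ↦ ?_) (fun y hy ↦ ?_) (by rw [mul_assoc, hT'_mul])
    · simp only [← mul_assoc]
      rw [← Finset.sum_mul, hfg, one_mul]
    · simp only [f', Finset.mul_sum, ← Finset.sum_add_distrib]
      calc f j = (∑ i, f i * g i) * f j := by rw [hfg, one_mul]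
        _ = _ := by
          rw [Finset.sum_mul]
          refine Finset.sum_congr rfl fun i _ ↦ ?_
          rw [mul_assoc, hpq]; ring
    · exact Subring.le_mul_toZSubmodule _ _ (Submodule.mem_sup_left
        (Subring.le_mul_toZSubmodule _ _ (Submodule.subset_span ⟨i, rfl⟩)))
    · exact Subring.le_mul_toZSubmodule _ _ (Submodule.mem_sup_right (hmulmem y hy))
  have hL'_mul : L' * T'.toZSubmodule = J' := by
    refine le_antisymm ((mul_le_mul' hLJ' le_rfl).trans hJ.mul_right.le) ?_
    refine h.le_of_generators (f := g) (f' := g') (g := f) (x := fun i ↦ ∑ j, q i j * g j)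
      (fun y _ ↦ ?_) (fun i y hy ↦ hJ.mul_mem (hf i) hy) (fun i ↦ ?_)
      (fun i ↦ J'.sum_mem fun j _ ↦ ?_) (fun i ↦ ?_) (fun y hy ↦ ?_) (by rw [mul_assoc, hT'_mul])
    · simp only [← mul_assoc]
      rw [← Finset.sum_mul]
      simp only [mul_comm (g _)]
      rw [hfg, one_mul]
    · simp only [g', Finset.mul_sum, ← Finset.sum_add_distrib]
      calc g i = g i * (∑ j, f j * g j) := by rw [hfg, mul_one]
        _ = _ := by
          rw [Finset.mul_sum]
          refine Finset.sum_congr rfl fun j _ ↦ ?_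
          rw [← mul_assoc, hpq]; ring
    · rw [mul_comm]; exact hJ.symm.smul_mem (hg j) (h.le (hq i j))
    · exact Subring.le_mul_toZSubmodule _ _ (Submodule.mem_sup_left
        (Subring.le_mul_toZSubmodule _ _ (Submodule.subset_span ⟨i, rfl⟩)))
    · exact Subring.le_mul_toZSubmodule _ _ (Submodule.mem_sup_right (hmulmem y hy))
  have hLL' : L * L' ≤ T.toZSubmodule := by
    have h1 : F * T.toZSubmodule * L' ≤ T.toZSubmodule := by
      rw [mul_assoc, mul_comm T.toZSubmodule, hLT'_mul]
      simp only [L']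
      rw [Submodule.mul_sup]
      refine sup_le ?_ ?_
      · rw [← mul_assoc]
        exact (mul_le_mul' hFG le_rfl).trans hTT.le
      · rw [mul_left_comm]
        exact (mul_le_mul' le_rfl ((mul_le_mul' hF le_rfl).trans hJ.mul_eq.le)).trans hβT
    have h2 : β * J * L' ≤ T.toZSubmodule := by
      rw [mul_assoc]
      exact (mul_le_mul' le_rfl ((mul_le_mul' le_rfl hLJ').trans hJ.mul_eq.le)).trans hβT
    calc L * L' = F * T.toZSubmodule * L' ⊔ β * J * L' := Submodule.sup_mul _ _ _
      _ ≤ _ := sup_le h1 h2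
  have hKT : L * L' * T.toZSubmodule = L * L' := by rw [mul_assoc, hLT'_mul]
  have hone : (1 : S) ∈ L * L' := h.one_mem_of_mul_eq hLL' hKT (by
    calc L * L' * T'.toZSubmodule = L * L' * (T'.toZSubmodule * T'.toZSubmodule) := by rw [hT'_mul]
      _ = L * T'.toZSubmodule * (L' * T'.toZSubmodule) := by rw [mul_mul_mul_comm]
      _ = T'.toZSubmodule := by rw [hLT', hL'_mul, hJ.mul_eq])
  refine ⟨L, L', ⟨hLT, hLT'_mul, le_antisymm hLL' fun x hx ↦ ?_⟩, hLT'⟩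
  rw [← hKT]
  simpa using Submodule.mul_mem_mul hone hx

end Lift

section Units

variable {S : Type*} [CommRing S]

/-- An invertible `R`-submodule, regarded as a `ℤ`-submodule. -/
def Subring.unitToZ {R : Subring S} (u : Additive (Submodule R S)ˣ) : Submodule ℤ S :=
  (u.toMul : Submodule R S).restrictScalars ℤ

namespace Subring

variable {R : Subring S}

theorem unitToZ_add (u v : Additive (Submodule R S)ˣ) :
    unitToZ (u + v) = unitToZ u * unitToZ v := rfl

theorem restrictScalars_one : (1 : Submodule R S).restrictScalars ℤ = R.toZSubmodule := by
  ext x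
  rw [Submodule.restrictScalars_mem, Submodule.mem_one, Subring.mem_toZSubmodule]
  exact ⟨fun ⟨y, hy⟩ ↦ hy ▸ y.2, fun hx ↦ ⟨⟨x, hx⟩, rfl⟩⟩

theorem unitToZ_zero : unitToZ (0 : Additive (Submodule R S)ˣ) = R.toZSubmodule :=
  restrictScalars_one

theorem unitToZ_injective : Function.Injective (unitToZ (R := R)) := fun _ _ h ↦
  Additive.toMul.injective (Units.ext (Submodule.restrictScalars_injective ℤ R S h))

theorem isInvertiblePair_unitToZ (u : Additive (Submodule R S)ˣ) :
    IsInvertiblePair R (unitToZ u) (unitToZ (-u)) where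
  mul_left := by rw [← unitToZ_zero, ← unitToZ_add, add_zero]
  mul_right := by rw [← unitToZ_zero, ← unitToZ_add, add_zero]
  mul_eq := by rw [← unitToZ_add, add_neg_cancel, unitToZ_zero]

end Subring

theorem IsInvertiblePair.exists_unit {R : Subring S} {J J' : Submodule ℤ S}
    (h : IsInvertiblePair R J J') :
    ∃ u : Additive (Submodule R S)ˣ, Subring.unitToZ u = J := by
  have lift : ∀ I : Submodule ℤ S, I * R.toZSubmodule = I →
      ∃ K : Submodule R S, K.restrictScalars ℤ = I := fun I hI ↦
    ⟨{ carrier := I, add_mem' := I.add_mem, zero_mem' := I.zero_mem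
       smul_mem' := fun r x hx ↦ by
        have := Submodule.mul_mem_mul hx (Subring.mem_toZSubmodule.2 r.2)
        rw [hI, mul_comm] at this
        exact this }, rfl⟩
  obtain ⟨K, hK⟩ := lift J h.mul_left
  obtain ⟨K', hK'⟩ := lift J' h.mul_right
  have hKK' : K * K' = 1 := by
    apply Submodule.restrictScalars_injective ℤ R S
    rw [Subring.restrictScalars_one, ← h.mul_eq, ← hK, ← hK']
    rfl
  exact ⟨Additive.ofMul ⟨K, K', hKK', by rw [mul_comm, hKK']⟩, hK⟩

namespace Subring

variable {R : Subring S}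

theorem unitToZ_neg_mul_eq {T : Subring S} (hRT : R ≤ T) {u : Additive (Submodule R S)ˣ}
    (hu : unitToZ u * T.toZSubmodule = T.toZSubmodule) :
    unitToZ (-u) * T.toZSubmodule = T.toZSubmodule := by
  conv_lhs => rw [← hu]
  rw [← mul_assoc, ← unitToZ_add, neg_add_cancel, unitToZ_zero, mul_comm,
    toZSubmodule_mul_of_le hRT]

theorem unitToZ_le {T : Subring S} {u : Additive (Submodule R S)ˣ}
    (hu : unitToZ u * T.toZSubmodule = T.toZSubmodule) : unitToZ u ≤ T.toZSubmodule :=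
  (le_mul_toZSubmodule _ _).trans hu.le

theorem unitToZ_mul_eq_of_le {T : Subring S} (hRT : R ≤ T) {u : Additive (Submodule R S)ˣ}
    (hu : unitToZ u ≤ T.toZSubmodule) (hu' : unitToZ (-u) ≤ T.toZSubmodule) :
    unitToZ u * T.toZSubmodule = T.toZSubmodule := by
  have hTT := (toZSubmodule_mul_of_le (le_refl T)).le
  refine le_antisymm ((mul_le_mul' hu le_rfl).trans hTT) ?_
  calc T.toZSubmodule = unitToZ u * (unitToZ (-u) * T.toZSubmodule) := by
        rw [← mul_assoc, (isInvertiblePair_unitToZ u).mul_eq, mul_comm,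
          toZSubmodule_mul_of_le hRT]
    _ ≤ unitToZ u * T.toZSubmodule :=
        mul_le_mul' le_rfl ((mul_le_mul' hu' le_rfl).trans hTT)

theorem unitToZ_mul_eq_iff {T : Subring S} (hRT : R ≤ T) {u : Additive (Submodule R S)ˣ} :
    unitToZ u * T.toZSubmodule = T.toZSubmodule ↔
      unitToZ u ≤ T.toZSubmodule ∧ unitToZ (-u) ≤ T.toZSubmodule :=
  ⟨fun h ↦ ⟨unitToZ_le h, unitToZ_le (unitToZ_neg_mul_eq hRT h)⟩,
    fun h ↦ unitToZ_mul_eq_of_le hRT h.1 h.2⟩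

/-- The invertible `R`-submodules that become trivial over the intermediate ring `T`; equivalently,
those that are invertible inside `T`. -/
def trivialOver {T : Subring S} (hRT : R ≤ T) : AddSubgroup (Additive (Submodule R S)ˣ) where
  carrier := {u | unitToZ u * T.toZSubmodule = T.toZSubmodule}
  add_mem' {u v} hu hv := by
    change unitToZ (u + v) * _ = _
    rw [unitToZ_add, mul_assoc, hv, hu]
  zero_mem' := by
    change unitToZ 0 * _ = _
    rw [unitToZ_zero, mul_comm, toZSubmodule_mul_of_le hRT]
  neg_mem' hu := unitToZ_neg_mul_eq hRT hu

end Subring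

/-- `Γ` is the graph of an isomorphism between `T / R` and the group of invertible `R`-submodules
of `T`, where moreover all invertible `T`-submodules of the ambient ring lift to `R`. -/
structure IsPartialIso (R : Subring S) (Γ : AddSubgroup (S × Additive (Submodule R S)ˣ))
    (T : Subring S) : Prop where
  le : R ≤ T
  fst_iff : ∀ x, x ∈ T ↔ ∃ u, (x, u) ∈ Γ
  snd_iff : ∀ u, Subring.unitToZ u * T.toZSubmodule = T.toZSubmodule ↔ ∃ x, (x, u) ∈ Γ
  ker : ∀ x u, (x, u) ∈ Γ → (x ∈ R ↔ u = 0)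
  lift : ∀ J J', IsInvertiblePair T J J' →
    ∃ u : Additive (Submodule R S)ˣ, Subring.unitToZ u * T.toZSubmodule = J

theorem isPartialIso_base (R : Subring S) :
    IsPartialIso R (AddSubgroup.prod R.toAddSubgroup ⊥) R where
  le := le_rfl
  fst_iff x := ⟨fun hx ↦ ⟨0, hx, rfl⟩, fun ⟨_, h⟩ ↦ h.1⟩
  snd_iff u := by
    rw [(Subring.isInvertiblePair_unitToZ u).mul_left, ← Subring.unitToZ_zero,
      Subring.unitToZ_injective.eq_iff]
    exact ⟨fun h ↦ ⟨0, R.zero_mem, h⟩, fun ⟨_, h⟩ ↦ h.2⟩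
  ker x u h := ⟨fun _ ↦ h.2, fun _ ↦ h.1⟩
  lift J J' h := by
    obtain ⟨u, hu⟩ := h.exists_unit
    exact ⟨u, by rw [hu, h.mul_left]⟩

theorem isPartialIso_iSup {R : Subring S} {ι : Type*} [Nonempty ι]
    {p : ι → AddSubgroup (S × Additive (Submodule R S)ˣ) × Subring S}
    (hp : Directed (· ≤ ·) p) (h : ∀ i, IsPartialIso R (p i).1 (p i).2) :
    IsPartialIso R (⨆ i, (p i).1) (⨆ i, (p i).2) := by
  have hd₁ : Directed (· ≤ ·) fun i ↦ (p i).1 := hp.mono_comp _ fun _ _ h ↦ h.1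
  have hd₂ : Directed (· ≤ ·) fun i ↦ (p i).2 := hp.mono_comp _ fun _ _ h ↦ h.2
  have mem₁ : ∀ {y}, y ∈ (⨆ i, (p i).1) ↔ ∃ i, y ∈ (p i).1 :=
    AddSubgroup.mem_iSup_of_directed hd₁
  have mem₂ : ∀ {y}, y ∈ (⨆ i, (p i).2) ↔ ∃ i, y ∈ (p i).2 :=
    Subring.mem_iSup_of_directed hd₂
  have hle₂ : ∀ i, (p i).2 ≤ ⨆ i, (p i).2 := le_iSup fun i ↦ (p i).2
  have hfin : ∀ {κ : Type} [Finite κ] (f : κ → S), (∀ k, f k ∈ ⨆ i, (p i).2) →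
      ∃ i, ∀ k, f k ∈ (p i).2 := by
    intro κ _ f hf
    choose j hj using fun k ↦ mem₂.1 (hf k)
    obtain ⟨i, hi⟩ := hd₂.finite_le j
    exact ⟨i, fun k ↦ hi k (hj k)⟩
  have hR : R ≤ ⨆ i, (p i).2 := (h (Classical.arbitrary ι)).le.trans (hle₂ _)
  refine ⟨hR, fun x ↦ ?_, fun u ↦ ?_, fun x u hxu ↦ ?_, fun J J' hJ ↦ ?_⟩
  · simp_rw [mem₂, mem₁, (h _).fst_iff]
    exact exists_comm
  · simp_rw [mem₁]
    rw [exists_comm]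
    simp_rw [← (h _).snd_iff, Subring.unitToZ_mul_eq_iff (h _).le]
    rw [Subring.unitToZ_mul_eq_iff hR]
    constructor
    · intro hu
      have hu₀ := Subring.isInvertiblePair_unitToZ u
      obtain ⟨κ, _, f, g, hf, hg, hfg⟩ := hu₀.exists_dual_families
      obtain ⟨i, hi⟩ := hfin (Sum.elim f g) (by
        rintro (k | k)
        exacts [hu.1 (hf k), hu.2 (hg k)])
      refine ⟨i, fun x hx ↦ ?_, fun x hx ↦ ?_⟩
      · have : x = ∑ k, f k * (x * g k) := by
          conv_lhs => rw [← one_mul x, ← hfg, Finset.sum_mul]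
          exact Finset.sum_congr rfl fun _ _ ↦ by ring
        rw [this]
        exact (p i).2.sum_mem fun k _ ↦ (p i).2.mul_mem (hi (.inl k))
          ((h i).le (hu₀.mul_mem hx (hg k)))
      · have : x = ∑ k, g k * (f k * x) := by
          conv_lhs => rw [← one_mul x, ← hfg, Finset.sum_mul]
          exact Finset.sum_congr rfl fun _ _ ↦ by ring
        rw [this]
        exact (p i).2.sum_mem fun k _ ↦ (p i).2.mul_mem (hi (.inr k))
          ((h i).le (hu₀.mul_mem (hf k) hx))
    · rintro ⟨i, hi₁, hi₂⟩
      exact ⟨hi₁.trans (hle₂ i), hi₂.trans (hle₂ i)⟩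
  · obtain ⟨i, hi⟩ := mem₁.1 hxu
    exact (h i).ker x u hi
  · obtain ⟨κ, _, f, g, hf, hg, hfg⟩ := hJ.exists_dual_families
    obtain ⟨i, hi⟩ := hfin (fun k : κ × κ ↦ f k.1 * g k.2) fun k ↦ hJ.mul_mem (hf k.1) (hg k.2)
    obtain ⟨u, hu⟩ := (h i).lift _ _ (isInvertiblePair_span (fun j k ↦ hi (j, k)) hfg)
    refine ⟨u, ?_⟩
    have hT := Subring.toZSubmodule_mul_of_le (hle₂ i)
    rw [← hT, mul_comm _ (p i).2.toZSubmodule, ← mul_assoc, hu, mul_assoc,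
      mul_comm (p i).2.toZSubmodule, hT]
    refine le_antisymm ?_ fun x hx ↦ ?_
    · refine (mul_le_mul' (Submodule.span_le.2 ?_) le_rfl).trans hJ.mul_left.le
      rintro _ ⟨k, rfl⟩
      exact hf k
    · have : x = ∑ k, f k * (x * g k) := by
        conv_lhs => rw [← one_mul x, ← hfg, Finset.sum_mul]
        exact Finset.sum_congr rfl fun _ _ ↦ by ring
      rw [this]
      exact Submodule.sum_mem _ fun k _ ↦ Submodule.mul_mem_mul (Submodule.subset_span ⟨k, rfl⟩)
        (hJ.mul_mem hx (hg k))

end Units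

section Step

variable {S : Type*} [CommRing S]

namespace IsElementaryExtension

variable {T T' : Subring S} {b : S} (h : IsElementaryExtension T T' b)
include h

theorem sq_mul_mem_of_mul_eq {J : Submodule ℤ S} (hJ : J * T.toZSubmodule = J)
    (hJ' : J * T'.toZSubmodule = T'.toZSubmodule) {y : S} (hy : y ∈ T') : b ^ 2 * y ∈ J := by
  have hle : Submodule.span ℤ {b ^ 2} * T'.toZSubmodule ≤ J := by
    rw [← hJ', mul_left_comm]
    exact (mul_le_mul' le_rfl h.span_sq_mul_le).trans hJ.le
  exact hle (Submodule.mul_mem_mul (Submodule.mem_span_singleton_self _)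
    (Subring.mem_toZSubmodule.2 hy))

theorem exists_one_add_mul_mem {J : Submodule ℤ S} (hJ : J * T.toZSubmodule = J)
    (hJ' : J * T'.toZSubmodule = T'.toZSubmodule) : ∃ t ∈ T, 1 + b * t ∈ J := by
  have hmul : ∀ k ∈ J, ∀ t ∈ T, k * t ∈ J := fun k hk t ht ↦
    hJ ▸ Submodule.mul_mem_mul hk (Subring.mem_toZSubmodule.2 ht)
  have hdecomp : ∀ x ∈ J * T'.toZSubmodule, ∃ k ∈ J, ∃ l ∈ J, x = k + b * l := by
    intro x hx
    refine Submodule.mul_induction_on hx ?_ ?_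
    · intro k hk y hy
      obtain ⟨p, hp, q, hq, rfl⟩ := (h.mem_iff y).1 hy
      exact ⟨k * p, hmul k hk p hp, k * q, hmul k hk q hq, by ring⟩
    · rintro _ _ ⟨k, hk, l, hl, rfl⟩ ⟨k', hk', l', hl', rfl⟩
      exact ⟨k + k', J.add_mem hk hk', l + l', J.add_mem hl hl', by ring⟩
  obtain ⟨k, hk, l, hl, hkl⟩ := hdecomp 1 (hJ'.symm ▸ Subring.mem_toZSubmodule.2 T'.one_mem)
  have hlT' : l ∈ T' := (Subring.le_mul_toZSubmodule T' J).trans hJ'.le hl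
  obtain ⟨p, hp, q, hq, rfl⟩ := (h.mem_iff l).1 hlT'
  refine ⟨-p, T.neg_mem hp, ?_⟩
  have : 1 + b * -p = k + b ^ 2 * q := by rw [hkl]; ring
  rw [this]
  exact J.add_mem hk (h.sq_mul_mem_of_mul_eq hJ hJ' (h.le hq))

/-- For `t ∈ T`, there is an invertible `T`-submodule of `T'` containing `1 + b t`. -/
theorem exists_invertible_one_add_mul_mem {t : S} (ht : t ∈ T) :
    ∃ J J' : Submodule ℤ S, IsInvertiblePair T J J' ∧
      J * T'.toZSubmodule = T'.toZSubmodule ∧ 1 + b * t ∈ J := by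
  let C := Submodule.span ℤ {b ^ 2} * T'.toZSubmodule
  have hTT : T.toZSubmodule * T.toZSubmodule = T.toZSubmodule :=
    Subring.toZSubmodule_mul_of_le le_rfl
  have hT'T := Subring.toZSubmodule_mul_of_le h.le
  have hT'_mul := Subring.toZSubmodule_mul_of_le (le_refl T')
  have hCT' : C * T'.toZSubmodule = C := by simp only [C]; rw [mul_assoc, hT'_mul]
  have hCT : C * T.toZSubmodule = C := by simp only [C]; rw [mul_assoc, hT'T]
  have hC : C ≤ T.toZSubmodule := h.span_sq_mul_le
  have hmemC : ∀ y ∈ T', b ^ 2 * y ∈ C := fun y hy ↦ Submodule.mul_mem_mul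
    (Submodule.mem_span_singleton_self _) (Subring.mem_toZSubmodule.2 hy)
  let J : S → Submodule ℤ S := fun s ↦ Submodule.span ℤ {1 + b * s} * T.toZSubmodule ⊔ C
  have hJC : ∀ s, C ≤ J s := fun s ↦ le_sup_right
  have hJmem : ∀ s, 1 + b * s ∈ J s := fun s ↦ le_sup_left (α := Submodule ℤ S)
    (Subring.le_mul_toZSubmodule _ _ (Submodule.mem_span_singleton_self _))
  have hJT : ∀ s, J s * T.toZSubmodule = J s := fun s ↦ by
    simp only [J]
    rw [Submodule.sup_mul, mul_assoc, hTT, hCT]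
  have hspan : ∀ s ∈ T, Submodule.span ℤ {1 + b * s} ≤ T'.toZSubmodule := fun s hs ↦ by
    rw [Submodule.span_singleton_le_iff_mem]
    exact T'.add_mem T'.one_mem (h.mul_mem hs)
  have hJT' : ∀ s ∈ T, J s ≤ T'.toZSubmodule := fun s hs ↦
    sup_le ((mul_le_mul' (hspan s hs) le_rfl).trans hT'T.le)
      (hC.trans (Subring.toZSubmodule_mono h.le))
  have ht' : -t ∈ T := T.neg_mem ht
  have hsqt : b ^ 2 * t ^ 2 ∈ C := hmemC _ (h.le (T.pow_mem ht 2))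
  have hone : (1 : S) ∈ J t * J (-t) := by
    have h1 : (1 + b * t) * (1 + b * -t) ∈ J t * J (-t) :=
      Submodule.mul_mem_mul (hJmem t) (hJmem (-t))
    have h2 : b ^ 2 * (t ^ 2 * (1 + b * t)) * (1 + b * -t) ∈ J t * J (-t) :=
      Submodule.mul_mem_mul (hJC t (hmemC _ (T'.mul_mem (h.le (T.pow_mem ht 2))
        (T'.add_mem T'.one_mem (h.mul_mem ht))))) (hJmem (-t))
    have h3 : b ^ 2 * t ^ 2 * (b ^ 2 * t ^ 2) ∈ J t * J (-t) :=
      Submodule.mul_mem_mul (hJC _ hsqt) (hJC _ hsqt)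
    convert Submodule.add_mem _ h1 (Submodule.add_mem _ h2 h3) using 1
    ring
  have hle : J t * J (-t) ≤ T.toZSubmodule := by
    have h1 : C * J (-t) ≤ T.toZSubmodule :=
      ((mul_le_mul' le_rfl (hJT' _ ht')).trans hCT'.le).trans hC
    have h2 : Submodule.span ℤ {1 + b * t} * T.toZSubmodule * J (-t) ≤ T.toZSubmodule := by
      rw [mul_assoc, mul_comm T.toZSubmodule, hJT]
      simp only [J]
      rw [Submodule.mul_sup]
      refine sup_le ?_ ?_
      · rw [← mul_assoc, Submodule.span_mul_span, Set.singleton_mul_singleton]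
        refine (mul_le_mul' ((Submodule.span_singleton_le_iff_mem _ _).2 ?_) le_rfl).trans hTT.le
        have : (1 + b * t) * (1 + b * -t) = 1 - b ^ 2 * t ^ 2 := by ring
        rw [this]
        exact T.sub_mem T.one_mem (hC hsqt)
      · rw [mul_comm]
        exact ((mul_le_mul' le_rfl (hspan t ht)).trans hCT'.le).trans hC
    calc J t * J (-t) = _ := Submodule.sup_mul _ _ _
      _ ≤ _ := sup_le h2 h1
  refine ⟨J t, J (-t), ⟨hJT t, hJT (-t), le_antisymm hle fun x hx ↦ ?_⟩,
    le_antisymm ((mul_le_mul' (hJT' t ht) le_rfl).trans hT'_mul.le) fun x hx ↦ ?_, hJmem t⟩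
  · rw [← hJT (-t), ← mul_assoc]
    simpa using Submodule.mul_mem_mul hone hx
  · have h1 : (1 + b * t) * (1 + b * -t) ∈ J t * T'.toZSubmodule :=
      Submodule.mul_mem_mul (hJmem t) (T'.add_mem T'.one_mem (h.mul_mem ht'))
    have h2 : (1 : S) ∈ J t * T'.toZSubmodule := by
      convert Submodule.add_mem _ h1
        (Subring.le_mul_toZSubmodule T' _ (hJC t hsqt)) using 1
      ring
    rw [← hT'_mul, ← mul_assoc]
    simpa using Submodule.mul_mem_mul h2 hx

end IsElementaryExtension

theorem IsPartialIso.exists_extension {R T T' : Subring S} {b : S}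
    {Γ : AddSubgroup (S × Additive (Submodule R S)ˣ)}
    (hdiv : ∀ k : ℤ, k ≠ 0 → ∃ r ∈ R, (k : S) * r = 1)
    (hΓ : IsPartialIso R Γ T) (h : IsElementaryExtension T T' b) :
    ∃ Γ', Γ ≤ Γ' ∧ IsPartialIso R Γ' T' := by
  have hRT := hΓ.le
  have hRT' := hRT.trans h.le
  have hTT' := Subring.toZSubmodule_mul_of_le h.le
  -- base change to `T` of the members of `trivialOver hRT'`
  have hbc₁ : ∀ u : Additive (Submodule R S)ˣ,
      Subring.unitToZ u * T.toZSubmodule * T.toZSubmodule = Subring.unitToZ u * T.toZSubmodule :=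
    fun u ↦ by rw [mul_assoc, Subring.toZSubmodule_mul_of_le le_rfl]
  have hbc₂ : ∀ u ∈ Subring.trivialOver hRT',
      Subring.unitToZ u * T.toZSubmodule * T'.toZSubmodule = T'.toZSubmodule := fun u hu ↦ by
    rw [mul_assoc, mul_comm T.toZSubmodule, hTT', hu]
  have hsq : ∀ u ∈ Subring.trivialOver hRT', ∀ y ∈ T',
      b ^ 2 * y ∈ Subring.unitToZ u * T.toZSubmodule := fun u hu y hy ↦
    h.sq_mul_mem_of_mul_eq (hbc₁ u) (hbc₂ u hu) hy
  have hmul : ∀ u v : Additive (Submodule R S)ˣ, ∀ x ∈ Subring.unitToZ u * T.toZSubmodule,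
      ∀ y ∈ Subring.unitToZ v * T.toZSubmodule,
      x * y ∈ Subring.unitToZ (u + v) * T.toZSubmodule := fun u v x hx y hy ↦ by
    have := Submodule.mul_mem_mul hx hy
    rwa [mul_mul_mul_comm, Subring.toZSubmodule_mul_of_le le_rfl] at this
  have hzero : Subring.unitToZ (0 : Additive (Submodule R S)ˣ) * T.toZSubmodule =
      T.toZSubmodule := by
    rw [Subring.unitToZ_zero, mul_comm, Subring.toZSubmodule_mul_of_le hRT]
  have hinv : ∀ u ∈ Subring.trivialOver hRT', ∀ t ∈ T,
      1 + b * t ∈ Subring.unitToZ u * T.toZSubmodule → ∃ t' ∈ T,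
        1 + b * t' ∈ Subring.unitToZ (-u) * T.toZSubmodule ∧ b * (t + t') ∈ T := by
    intro u hu t ht hut
    obtain ⟨t', ht', hut'⟩ := h.exists_one_add_mul_mem (hbc₁ (-u))
      (hbc₂ (-u) (neg_mem hu))
    refine ⟨t', ht', hut', ?_⟩
    have h1 := hmul u (-u) _ hut _ hut'
    rw [add_neg_cancel, hzero, Subring.mem_toZSubmodule] at h1
    have : b * (t + t') = (1 + b * t) * (1 + b * t') - 1 - b ^ 2 * (t * t') := by ring
    rw [this]
    exact T.sub_mem (T.sub_mem h1 T.one_mem) (T.mul_mem h.sq_mem (T.mul_mem ht ht'))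
  let Ψ : AddSubgroup (S × Additive (Submodule R S)ˣ) :=
    { carrier := {y | y.2 ∈ Subring.trivialOver hRT' ∧ ∃ t ∈ T, y.1 - b * t ∈ T ∧
        1 + b * t ∈ Subring.unitToZ y.2 * T.toZSubmodule}
      add_mem' := by
        rintro ⟨x, u⟩ ⟨y, v⟩ ⟨hu, t, ht, hxt, hut⟩ ⟨hv, s, hs, hys, hvs⟩
        refine ⟨add_mem hu hv, t + s, T.add_mem ht hs, ?_, ?_⟩
        · convert T.add_mem hxt hys using 1
          simp only [Prod.mk_add_mk]
          ring
        · have : 1 + b * (t + s) = (1 + b * t) * (1 + b * s) - b ^ 2 * (t * s) := by ring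
          rw [this]
          exact Submodule.sub_mem _ (hmul u v _ hut _ hvs)
            (hsq _ (add_mem hu hv) _ (h.le (T.mul_mem ht hs)))
      zero_mem' := ⟨zero_mem _, 0, T.zero_mem, by simp, by
        simp only [Prod.snd_zero, mul_zero, add_zero]
        rw [hzero]
        exact T.one_mem⟩
      neg_mem' := by
        rintro ⟨x, u⟩ ⟨hu, t, ht, hxt, hut⟩
        obtain ⟨t', ht', hut', htt'⟩ := hinv u hu t ht hut
        refine ⟨neg_mem hu, t', ht', ?_, hut'⟩
        have : -x - b * t' = -(x - b * t) - b * (t + t') := by ring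
        change -x - b * t' ∈ T
        rw [this]
        exact T.sub_mem (T.neg_mem hxt) htt' }
  have hone : ∀ u ∈ Subring.trivialOver hRT', ∀ t ∈ T,
      1 + b * t ∈ Subring.unitToZ u * T.toZSubmodule → b * t ∈ T →
      (1 : S) ∈ Subring.unitToZ u * T.toZSubmodule := by
    intro u hu t ht hut hbt
    have h1 : (1 + b * t) * (1 - b * t) ∈ Subring.unitToZ u * T.toZSubmodule := by
      rw [← hbc₁]
      exact Submodule.mul_mem_mul hut
        (Subring.mem_toZSubmodule.2 (T.sub_mem T.one_mem hbt))
    convert Submodule.add_mem _ h1 (hsq u hu _ (h.le (T.pow_mem ht 2))) using 1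
    ring
  have htriv : ∀ x u, (x, u) ∈ Ψ → (x ∈ T ↔ u ∈ Subring.trivialOver hRT) := by
    rintro x u ⟨hu, t, ht, hxt, hut⟩
    simp only at hu hxt hut
    constructor
    · intro hx
      have hbt : b * t ∈ T := by simpa using T.sub_mem hx hxt
      obtain ⟨t', ht', hut', htt'⟩ := hinv u hu t ht hut
      have hbt' : b * t' ∈ T := by
        have : b * t' = b * (t + t') - b * t := by ring
        rw [this]
        exact T.sub_mem htt' hbt
      have key : ∀ v : Additive (Submodule R S)ˣ,
          (1 : S) ∈ Subring.unitToZ v * T.toZSubmodule →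
          T.toZSubmodule ≤ Subring.unitToZ v * T.toZSubmodule := fun v hv y hy ↦ by
        rw [← hbc₁]
        simpa using Submodule.mul_mem_mul hv hy
      have h1 := key _ (hone u hu t ht hut hbt)
      have h2 := key _ (hone (-u) (neg_mem hu) t' ht' hut' hbt')
      refine le_antisymm ?_ h1
      calc Subring.unitToZ u * T.toZSubmodule
          ≤ Subring.unitToZ u * (Subring.unitToZ (-u) * T.toZSubmodule) := mul_le_mul' le_rfl h2
        _ = T.toZSubmodule := by
          rw [← mul_assoc, ← Subring.unitToZ_add, add_neg_cancel, hzero]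
    · intro huT
      rw [huT] at hut
      have hbt : b * t ∈ T := by simpa using T.sub_mem hut T.one_mem
      simpa using T.add_mem hxt hbt
  let N := AddSubgroup.prod T.toAddSubgroup (Subring.trivialOver hRT)
  have hΓN : Γ ≤ N := fun ⟨x, u⟩ hxu ↦ ⟨(hΓ.fst_iff x).2 ⟨u, hxu⟩, (hΓ.snd_iff u).2 ⟨x, hxu⟩⟩
  have hNΨ : N ≤ Ψ := by
    rintro ⟨x, u⟩ ⟨hx, hu⟩
    change x ∈ T at hx
    change Subring.unitToZ u * T.toZSubmodule = T.toZSubmodule at hu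
    refine ⟨?_, 0, T.zero_mem, by simpa using hx, ?_⟩
    · change Subring.unitToZ u * T'.toZSubmodule = T'.toZSubmodule
      rw [← hTT', mul_left_comm, hu]
    · simp only [mul_zero, add_zero]
      rw [hu]
      exact T.one_mem
  obtain ⟨Γ', hΓΓ', hΓ'Ψ, hΓ'N, hΨ⟩ := AddSubgroup.exists_complement_above hΓN hNΨ (by
    rintro ⟨x, u⟩ ⟨hx, hu⟩ k hk
    obtain ⟨x', hx'⟩ := (hΓ.snd_iff u).1 hu
    obtain ⟨r, hr, hkr⟩ := hdiv k hk
    refine ⟨(r * (x - x'), 0), ⟨T.mul_mem (hRT hr)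
      (T.sub_mem hx ((hΓ.fst_iff x').2 ⟨u, hx'⟩)), zero_mem _⟩, ?_⟩
    convert hx' using 1
    ext1
    · simp only [Prod.smul_mk, Prod.mk_sub_mk, zsmul_eq_mul]
      rw [← mul_assoc, hkr]
      ring
    · simp)
  refine ⟨Γ', hΓΓ', hRT', fun x ↦ ⟨fun hx ↦ ?_, fun ⟨u, hxu⟩ ↦ ?_⟩,
    fun u ↦ ⟨fun hu ↦ ?_, fun ⟨x, hxu⟩ ↦ (hΓ'Ψ hxu).1⟩, fun x u hxu ↦ ?_, fun J J' hJ ↦ ?_⟩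
  · obtain ⟨p, hp, t, ht, rfl⟩ := (h.mem_iff x).1 hx
    obtain ⟨J, J', hJ, hJT', hJt⟩ := h.exists_invertible_one_add_mul_mem ht
    obtain ⟨u, hu⟩ := hΓ.lift J J' hJ
    have huΨ : (p + b * t, u) ∈ Ψ := by
      refine ⟨?_, t, ht, by simpa using hp, by rwa [hu]⟩
      change Subring.unitToZ u * T'.toZSubmodule = T'.toZSubmodule
      rw [← hTT', mul_comm T'.toZSubmodule, ← mul_assoc, hu, hJT', mul_comm, hTT']
    obtain ⟨⟨y, v⟩, ⟨hy, hv⟩, hyv⟩ := hΨ _ huΨ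
    obtain ⟨v', hv'⟩ := (hΓ.fst_iff y).1 hy
    refine ⟨u - v + v', ?_⟩
    simpa using Γ'.add_mem hyv (hΓΓ' hv')
  · obtain ⟨-, t, ht, hxt, -⟩ := hΓ'Ψ hxu
    simpa using T'.add_mem (h.le hxt) (h.mul_mem ht)
  · obtain ⟨t, ht, hut⟩ := h.exists_one_add_mul_mem (hbc₁ u) (hbc₂ u hu)
    have huΨ : (b * t, u) ∈ Ψ := ⟨hu, t, ht, by simp [T.zero_mem], hut⟩
    obtain ⟨⟨y, v⟩, ⟨hy, hv⟩, hyv⟩ := hΨ _ huΨ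
    obtain ⟨y', hy'⟩ := (hΓ.snd_iff v).1 hv
    refine ⟨b * t - y + y', ?_⟩
    simpa using Γ'.add_mem hyv (hΓΓ' hy')
  · constructor
    · intro hx
      have hxT := hRT hx
      exact (hΓ.ker x u (hΓ'N _ hxu ⟨hxT, (htriv x u (hΓ'Ψ hxu)).1 hxT⟩)).1 hx
    · rintro rfl
      have h0 : (0 : Additive (Submodule R S)ˣ) ∈ Subring.trivialOver hRT := zero_mem _
      exact (hΓ.ker x 0 (hΓ'N _ hxu ⟨(htriv x 0 (hΓ'Ψ hxu)).2 h0, h0⟩)).2 rfl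
  · obtain ⟨L, L', hL, hLJ⟩ := h.exists_lift hJ
    obtain ⟨u, hu⟩ := hΓ.lift L L' hL
    refine ⟨u, ?_⟩
    rw [← hTT', mul_comm T'.toZSubmodule, ← mul_assoc, hu, hLJ]

/-- **Roberts–Singh.** For a subintegral extension `R ⊆ S` of `ℚ`-algebras, the group of invertible
`R`-submodules of `S` is isomorphic to `S / R`. -/
theorem nonempty_quotient_addEquiv_units_submodule (R : Subring S)
    (hdiv : ∀ k : ℤ, k ≠ 0 → ∃ r ∈ R, (k : S) * r = 1)
    (hsub : ∀ T : Subring S, R ≤ T → (∀ x, x ^ 2 ∈ T → x ^ 3 ∈ T → x ∈ T) → T = ⊤) :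
    Nonempty (S ⧸ R.toAddSubgroup ≃+ Additive (Submodule R S)ˣ) := by
  obtain ⟨⟨Γ, T⟩, hΓ, hmax⟩ := (zorn_le_nonempty₀
    {p : AddSubgroup (S × Additive (Submodule R S)ˣ) × Subring S | IsPartialIso R p.1 p.2}
    (fun c hc hchain y hy ↦ by
      have : Nonempty c := ⟨⟨y, hy⟩⟩
      exact ⟨(⨆ i : c, i.1.1, ⨆ i : c, i.1.2),
        isPartialIso_iSup (p := fun i : c ↦ i.1) hchain.directed fun i ↦ hc i.2,
        fun z hz ↦ ⟨le_iSup (fun i : c ↦ i.1.1) ⟨z, hz⟩, le_iSup (fun i : c ↦ i.1.2) ⟨z, hz⟩⟩⟩)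
    (_, R) (isPartialIso_base R)).imp fun _ h ↦ h.2
  change IsPartialIso R Γ T at hΓ
  obtain rfl : T = ⊤ := hsub T hΓ.le fun b h2 h3 ↦ by
    obtain ⟨T', hT'⟩ := exists_isElementaryExtension h2 h3
    obtain ⟨Γ', hle, hΓ'⟩ := hΓ.exists_extension hdiv hT'
    exact (hmax (y := (Γ', T')) hΓ' ⟨hle, hT'.le⟩).2 hT'.gen_mem
  let π₁ : Γ →+ S ⧸ R.toAddSubgroup :=
    (QuotientAddGroup.mk' R.toAddSubgroup).comp ((AddMonoidHom.fst _ _).comp Γ.subtype)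
  let π₂ : Γ →+ Additive (Submodule R S)ˣ := (AddMonoidHom.snd _ _).comp Γ.subtype
  have h₁ : Function.Surjective π₁ := fun a ↦ by
    obtain ⟨x, rfl⟩ := QuotientAddGroup.mk_surjective a
    obtain ⟨u, hu⟩ := (hΓ.fst_iff x).1 trivial
    exact ⟨⟨_, hu⟩, rfl⟩
  have h₂ : Function.Surjective π₂ := fun u ↦ by
    obtain ⟨x, hx⟩ := (hΓ.snd_iff u).1
      (Subring.unitToZ_mul_eq_of_le le_top (fun _ _ ↦ trivial) fun _ _ ↦ trivial)
    exact ⟨⟨_, hx⟩, rfl⟩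
  have hker : π₁.ker = π₂.ker := by
    ext ⟨⟨x, u⟩, hxu⟩
    rw [AddMonoidHom.mem_ker, AddMonoidHom.mem_ker]
    exact (QuotientAddGroup.eq_zero_iff x).trans (hΓ.ker x u hxu)
  exact ⟨(QuotientAddGroup.quotientKerEquivOfSurjective π₁ h₁).symm.trans
    ((QuotientAddGroup.quotientAddEquivOfEq hker).trans
      (QuotientAddGroup.quotientKerEquivOfSurjective π₂ h₂))⟩

end Step

section SubintegralClosure

variable {B : Type*} [CommRing B] {A : Subring B}

namespace Subring

theorem le_subintegralClosure : A ≤ A.subintegralClosure :=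
  le_sInf fun _ hT ↦ hT.1

theorem isSubintegrallyClosedIn_subintegralClosure : A.subintegralClosure.IsSubintegrallyClosedIn :=
  fun b h2 h3 ↦ mem_sInf.2 fun T hT ↦ hT.2 b trivial (mem_sInf.1 h2 T hT) (mem_sInf.1 h3 T hT)

theorem subintegralClosure_le {T : Subring B} (hA : A ≤ T) (hT : T.IsSubintegrallyClosedIn) :
    A.subintegralClosure ≤ T :=
  sInf_le ⟨hA, fun b _ ↦ hT b⟩

theorem eq_top_of_comap_le_of_isSubintegrallyClosedIn {T : Subring A.subintegralClosure}
    (hA : A.comap A.subintegralClosure.subtype ≤ T) (hT : T.IsSubintegrallyClosedIn) : T = ⊤ := by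
  have h : A.subintegralClosure ≤ T.map A.subintegralClosure.subtype := by
    refine subintegralClosure_le (fun a ha ↦ ⟨⟨a, le_subintegralClosure ha⟩, hA ha, rfl⟩) ?_
    rintro b ⟨x, hx, hxb⟩ ⟨y, hy, hyb⟩
    have hb : b ∈ A.subintegralClosure := isSubintegrallyClosedIn_subintegralClosure b
      (hxb ▸ x.2) (hyb ▸ y.2)
    have h2 : (⟨b, hb⟩ : A.subintegralClosure) ^ 2 = x := Subtype.ext hxb.symm
    have h3 : (⟨b, hb⟩ : A.subintegralClosure) ^ 3 = y := Subtype.ext hyb.symm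
    exact ⟨⟨b, hb⟩, hT _ (h2 ▸ hx) (h3 ▸ hy), rfl⟩
  refine eq_top_iff.2 fun x _ ↦ ?_
  obtain ⟨y, hy, hyx⟩ := h x.2
  rwa [← Subtype.ext hyx]

end Subring

section MonoidAlgebra

variable {M : Type*} [CommMonoid M]

theorem mem_monoidAlgebraSubring_top {x : MonoidAlgebra B M} :
    x ∈ monoidAlgebraSubring A (⊤ : Submonoid M) ↔ ∀ m, x.coeff m ∈ A := by
  refine ⟨fun hx ↦ ?_, fun hx ↦ ?_⟩
  · induction hx using Subring.closure_induction with
    | mem x hx =>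
      obtain ⟨a, ha, n, -, rfl⟩ := hx
      intro m
      rw [MonoidAlgebra.coeff_single, Finsupp.single_apply]
      split_ifs
      exacts [ha, A.zero_mem]
    | zero => exact fun _ ↦ A.zero_mem
    | one =>
      intro m
      rw [MonoidAlgebra.one_def, MonoidAlgebra.coeff_single, Finsupp.single_apply]
      split_ifs
      exacts [A.one_mem, A.zero_mem]
    | add x y _ _ hx hy => exact fun m ↦ A.add_mem (hx m) (hy m)
    | neg x _ hx => exact fun m ↦ A.neg_mem (hx m)
    | mul x y _ _ hx hy =>
      intro m
      rw [MonoidAlgebra.coeff_mul]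
      refine sum_mem fun i _ ↦ sum_mem fun j _ ↦ ?_
      dsimp only
      split_ifs
      exacts [A.mul_mem (hx i) (hy j), A.zero_mem]
  · rw [← MonoidAlgebra.sum_coeff_single x]
    exact sum_mem fun m _ ↦ Subring.subset_closure ⟨_, hx m, m, trivial, rfl⟩

theorem single_mem_monoidAlgebraSubring_top {a : B} (ha : a ∈ A) (m : M) :
    MonoidAlgebra.single m a ∈ monoidAlgebraSubring A (⊤ : Submonoid M) :=
  Subring.subset_closure ⟨a, ha, m, trivial, rfl⟩

theorem eq_top_of_comap_monoidAlgebraSubring_le_of_isSubintegrallyClosedIn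
    {T : Subring (monoidAlgebraSubring A.subintegralClosure (⊤ : Submonoid M))}
    (hA : (monoidAlgebraSubring A (⊤ : Submonoid M)).comap
      (monoidAlgebraSubring A.subintegralClosure (⊤ : Submonoid M)).subtype ≤ T)
    (hT : T.IsSubintegrallyClosedIn) : T = ⊤ := by
  let ι : A.subintegralClosure →+* monoidAlgebraSubring A.subintegralClosure (⊤ : Submonoid M) :=
    (MonoidAlgebra.singleOneRingHom.comp A.subintegralClosure.subtype).codRestrict _
      fun c ↦ single_mem_monoidAlgebraSubring_top c.2 1
  have hι : T.comap ι = ⊤ := by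
    refine Subring.eq_top_of_comap_le_of_isSubintegrallyClosedIn (fun a ha ↦ hA ?_) fun c h2 h3 ↦ ?_
    · exact single_mem_monoidAlgebraSubring_top (A := A) (Subring.mem_comap.1 ha) 1
    · rw [Subring.mem_comap, map_pow] at h2 h3
      exact hT _ h2 h3
  have h : monoidAlgebraSubring A.subintegralClosure (⊤ : Submonoid M) ≤
      T.map (Subring.subtype _) := by
    refine Subring.closure_le.2 ?_
    rintro _ ⟨c, hc, m, -, rfl⟩
    have h1 : ι ⟨c, hc⟩ ∈ T := by
      rw [← Subring.mem_comap, hι]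
      trivial
    have h2 : ⟨MonoidAlgebra.single m 1,
        single_mem_monoidAlgebraSubring_top (Subring.one_mem _) m⟩ ∈ T :=
      hA (single_mem_monoidAlgebraSubring_top A.one_mem m)
    refine ⟨_, T.mul_mem h1 h2, ?_⟩
    change MonoidAlgebra.single 1 c * MonoidAlgebra.single m 1 = MonoidAlgebra.single m c
    rw [MonoidAlgebra.single_mul_single, one_mul, mul_one]
  refine eq_top_iff.2 fun x _ ↦ ?_
  obtain ⟨y, hy, hyx⟩ := h x.2
  rwa [← Subtype.ext hyx]

/-- `C[M] / A[M]` is the direct sum of copies of `C / A` indexed by `M`. -/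
theorem nonempty_quotient_monoidAlgebraSubring_addEquiv (A C : Subring B) (M : Type*)
    [CommMonoid M] :
    Nonempty ((monoidAlgebraSubring C (⊤ : Submonoid M)) ⧸
        ((monoidAlgebraSubring A (⊤ : Submonoid M)).comap
          (monoidAlgebraSubring C (⊤ : Submonoid M)).subtype).toAddSubgroup ≃+
      (M →₀ C ⧸ (A.comap C.subtype).toAddSubgroup)) := by
  let φ : (M →₀ C) →+ monoidAlgebraSubring C (⊤ : Submonoid M) :=
    (MonoidAlgebra.coeffAddEquiv.symm.toAddMonoidHom.comp
      (Finsupp.mapRange.addMonoidHom C.subtype.toAddMonoidHom)).codRestrict _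
      fun f ↦ mem_monoidAlgebraSubring_top.2 fun m ↦ (f m).2
  have hφ : Function.Surjective φ := fun x ↦ by
    refine ⟨Finsupp.onFinset x.1.coeff.support
      (fun m ↦ ⟨x.1.coeff m, mem_monoidAlgebraSubring_top.1 x.2 m⟩) fun m hm ↦ ?_, ?_⟩
    · exact Finsupp.mem_support_iff.2 fun h ↦ hm (Subtype.ext h)
    · exact Subtype.ext (MonoidAlgebra.coeff_injective (Finsupp.ext fun m ↦ rfl))
  let π₁ := (QuotientAddGroup.mk' ((monoidAlgebraSubring A (⊤ : Submonoid M)).comap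
    (monoidAlgebraSubring C (⊤ : Submonoid M)).subtype).toAddSubgroup).comp φ
  let π₂ : (M →₀ C) →+ (M →₀ C ⧸ (A.comap C.subtype).toAddSubgroup) :=
    Finsupp.mapRange.addMonoidHom (QuotientAddGroup.mk' _)
  have h₁ : Function.Surjective π₁ := (QuotientAddGroup.mk'_surjective _).comp hφ
  have h₂ : Function.Surjective π₂ :=
    Finsupp.mapRange_surjective _ (map_zero _) (QuotientAddGroup.mk'_surjective _)
  have hker : π₁.ker = π₂.ker := by
    ext f
    rw [AddMonoidHom.mem_ker, AddMonoidHom.mem_ker, Finsupp.ext_iff]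
    exact ((QuotientAddGroup.eq_zero_iff (φ f)).trans mem_monoidAlgebraSubring_top).trans
      (forall_congr' fun m ↦
        (QuotientAddGroup.eq_zero_iff (N := (A.comap C.subtype).toAddSubgroup) (f m)).symm)
  exact ⟨(QuotientAddGroup.quotientKerEquivOfSurjective π₁ h₁).symm.trans
    ((QuotientAddGroup.quotientAddEquivOfEq hker).trans
      (QuotientAddGroup.quotientKerEquivOfSurjective π₂ h₂))⟩

end MonoidAlgebra

theorem Subring.exists_mem_comap_intCast_mul_eq_one [Algebra ℚ B] {A C : Subring B} (hAC : A ≤ C)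
    (hQ : ∀ q : ℚ, algebraMap ℚ B q ∈ A) (k : ℤ) (hk : k ≠ 0) :
    ∃ r ∈ A.comap C.subtype, (k : C) * r = 1 := by
  refine ⟨⟨_, hAC (hQ (k : ℚ)⁻¹)⟩, hQ _, Subtype.ext ?_⟩
  have h : (k : ℚ) ≠ 0 := Int.cast_ne_zero.2 hk
  change (((k : C) : B)) * algebraMap ℚ B (k : ℚ)⁻¹ = 1
  rw [Subring.coe_intCast, ← map_intCast (algebraMap ℚ B), ← map_mul, mul_inv_cancel₀ h, map_one]

end SubintegralClosure

/-- **Sarwar, Theorem 1.4(ii).**  Let `A ⊆ B` be an extension of commutative rings with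
`ℚ ⊆ A`, `⁺A` the subintegral closure of `A` in `B`, and `M` a positive commutative
cancellative torsion-free monoid.  Then
`𝓘(A[M],(⁺A)[M]) ≅ ℤ[M] ⊗_ℤ 𝓘(A,⁺A)` as abelian groups. -/
theorem invertibleSubmodules_monoidAlgebra_iso_tensor
    {B : Type*} [CommRing B] [Algebra ℚ B] (A : Subring B)
    (hQ : ∀ q : ℚ, algebraMap ℚ B q ∈ A)
    {M : Type*} [CancelCommMonoid M]
    (htf : MulTorsionFree M) (hpos : IsPositiveMonoid M) :
    Nonempty
      (Additive (Submodule
          ((monoidAlgebraSubring A (⊤ : Submonoid M)).comap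
            (monoidAlgebraSubring (A.subintegralClosure) (⊤ : Submonoid M)).subtype)
          (monoidAlgebraSubring (A.subintegralClosure) (⊤ : Submonoid M)))ˣ ≃+
        TensorProduct ℤ (MonoidAlgebra ℤ M)
          (Additive (Submodule (A.comap (A.subintegralClosure).subtype)
            (A.subintegralClosure))ˣ)) := by
  have hle := A.le_subintegralClosure
  have hleM : monoidAlgebraSubring A (⊤ : Submonoid M) ≤
      monoidAlgebraSubring A.subintegralClosure (⊤ : Submonoid M) := fun x hx ↦
    mem_monoidAlgebraSubring_top.2 fun m ↦ hle (mem_monoidAlgebraSubring_top.1 hx m)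
  have hQM (q : ℚ) : algebraMap ℚ (MonoidAlgebra B M) q ∈
      monoidAlgebraSubring A (⊤ : Submonoid M) :=
    single_mem_monoidAlgebraSubring_top (hQ q) 1
  obtain ⟨e⟩ := nonempty_quotient_addEquiv_units_submodule (A.comap A.subintegralClosure.subtype)
    (Subring.exists_mem_comap_intCast_mul_eq_one hle hQ)
    fun T ↦ Subring.eq_top_of_comap_le_of_isSubintegrallyClosedIn
  obtain ⟨eM⟩ := nonempty_quotient_addEquiv_units_submodule
    ((monoidAlgebraSubring A (⊤ : Submonoid M)).comap
      (monoidAlgebraSubring A.subintegralClosure (⊤ : Submonoid M)).subtype)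
    (Subring.exists_mem_comap_intCast_mul_eq_one hleM hQM)
    fun T ↦ eq_top_of_comap_monoidAlgebraSubring_le_of_isSubintegrallyClosedIn
  obtain ⟨q⟩ := nonempty_quotient_monoidAlgebraSubring_addEquiv A A.subintegralClosure M
  exact ⟨eM.symm.trans <| q.trans <| (Finsupp.mapRange.addEquiv e).trans
    (TensorProduct.congr MonoidAlgebra.coeffAddEquiv.toIntLinearEquiv (LinearEquiv.refl ℤ _) ≪≫ₗ
      TensorProduct.finsuppScalarLeft ℤ _ M).symm.toAddEquiv⟩
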